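/- arXiv:1512.05794 — 2 statements merged into one kernel-verified Lean document; each statement's English description precedes it below -/
import Mathlib

section
/- The limit lim_{ε → 0⁺} ( ∫_ε^∞ (sin u)/u² du + log ε ) exists and equals 1 − γ, where γ is the Euler–Mascheroni constant. -/
open MeasureTheory Filter Real

open Set Topology

theorem tendsto_setIntegral_Ioi_nhdsGT {f : ℝ → ℝ} {a : ℝ} (hf : IntegrableOn f (Ioi a)) :
    Tendsto (fun ε : ℝ => ∫ u in Ioi ε, f u) (𝓝[>] a) (𝓝 (∫ u in Ioi a, f u)) := by
  have hcover : AECover (volume.restrict (Ioi a)) (𝓝[>] a) (fun ε : ℝ => Ioi ε) :=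
    aecover_Ioi_of_Ioi (tendsto_id.mono_left nhdsWithin_le_nhds)
  refine (hcover.integral_tendsto_of_countably_generated hf).congr' ?_
  filter_upwards [self_mem_nhdsWithin] with ε hε
  rw [Measure.restrict_restrict measurableSet_Ioi,
    inter_eq_left.mpr (Ioi_subset_Ioi (le_of_lt hε))]

theorem integrableOn_log_mul_exp_neg :
    IntegrableOn (fun x : ℝ => log x * exp (-x)) (Ioi 0) := by
  rw [← Ioc_union_Ioi_eq_Ioi zero_le_one]
  refine IntegrableOn.union ?_ ?_
  · have hlog : IntegrableOn log (Ioc 0 1) :=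
      (intervalIntegrable_iff_integrableOn_Ioc_of_le zero_le_one).mp
        intervalIntegral.intervalIntegrable_log'
    refine Integrable.mono' hlog.norm (by fun_prop) ?_
    filter_upwards [ae_restrict_mem measurableSet_Ioc] with x hx
    rw [norm_mul, norm_of_nonneg (exp_pos _).le]
    exact mul_le_of_le_one_right (norm_nonneg _) (exp_le_one_iff.mpr (by linarith [hx.1]))
  · have hGamma : IntegrableOn (fun x : ℝ => exp (-x) * x ^ ((2 : ℝ) - 1)) (Ioi 1) :=
      (GammaIntegral_convergent two_pos).mono_set (Ioi_subset_Ioi zero_le_one)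
    refine Integrable.mono' hGamma (by fun_prop) ?_
    filter_upwards [ae_restrict_mem measurableSet_Ioi] with x hx
    have hx : 1 < x := hx
    rw [norm_of_nonneg (mul_nonneg (log_nonneg hx.le) (exp_pos _).le), mul_comm]
    norm_num
    gcongr
    exact log_le_self (zero_lt_one.trans hx).le

theorem integral_log_mul_exp_neg :
    ∫ x in Ioi (0 : ℝ), log x * exp (-x) = -eulerMascheroniConstant := by
  have hderiv := Complex.hasDerivAt_GammaIntegral (s := 1) (by simp)
  have heq : Complex.Gamma =ᶠ[𝓝 1] Complex.GammaIntegral := by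
    filter_upwards [(isOpen_lt continuous_const Complex.continuous_re).mem_nhds
      (show (0 : ℝ) < (1 : ℂ).re by simp)] with s hs
    exact Complex.Gamma_eq_integral hs
  have h := (hderiv.congr_of_eventuallyEq heq).unique Complex.hasDerivAt_Gamma_one
  simp only [sub_self, Complex.cpow_zero, one_mul] at h
  have hcast := integral_ofReal (𝕜 := ℂ) (μ := volume.restrict (Ioi 0))
    (f := fun x : ℝ => log x * exp (-x))
  apply Complex.ofReal_injective
  simp only [RCLike.ofReal_mul, Complex.coe_algebraMap] at hcast
  push_cast at h hcast ⊢
  rw [← h]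
  exact hcast.symm

theorem integrableOn_exp_neg_div_Ioi {ε : ℝ} (hε : 0 < ε) :
    IntegrableOn (fun x : ℝ => exp (-x) / x) (Ioi ε) := by
  refine Integrable.mono' ((integrableOn_exp_neg_Ioi ε).div_const ε) ?_ ?_
  · exact (by fun_prop : Measurable fun x : ℝ => exp (-x) / x).aestronglyMeasurable
  filter_upwards [ae_restrict_mem measurableSet_Ioi] with x hx
  have hx : ε < x := hx
  rw [norm_of_nonneg (div_nonneg (exp_pos _).le (hε.trans hx).le)]
  gcongr

theorem integral_exp_neg_div_Ioi {ε : ℝ} (hε : 0 < ε) :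
    ∫ x in Ioi ε, exp (-x) / x = (∫ x in Ioi ε, log x * exp (-x)) - log ε * exp (-ε) := by
  have hne {x : ℝ} (hx : ε < x) : x ≠ 0 := (hε.trans hx).ne'
  have hparts := integral_Ioi_mul_deriv_eq_deriv_mul (a := ε)
    (u := log) (v := fun x => -exp (-x)) (u' := fun x => x⁻¹) (v' := fun x => exp (-x))
    (a' := log ε * (-exp (-ε))) (b' := 0)
    (fun x hx => hasDerivAt_log (hne hx))
    (fun x _ => by simpa using! ((hasDerivAt_neg x).exp).neg)
    (integrableOn_log_mul_exp_neg.mono_set (Ioi_subset_Ioi hε.le))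
    ((integrableOn_exp_neg_div_Ioi hε).neg.congr_fun
      (fun x _ => by simp [div_eq_mul_inv, mul_comm]) measurableSet_Ioi)
    ?_ ?_
  · rw [hparts]
    have : (∫ x in Ioi ε, x⁻¹ * -exp (-x)) = -∫ x in Ioi ε, exp (-x) / x := by
      rw [← integral_neg]
      congr with x
      ring
    rw [this]
    ring
  · have : ContinuousAt (fun x : ℝ => log x * (-exp (-x))) ε :=
      (continuousAt_log hε.ne').mul (by fun_prop)
    exact this.tendsto.mono_left nhdsWithin_le_nhds
  · have hlin : Tendsto (fun x : ℝ => x * exp (-x)) atTop (𝓝 0) := by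
      simpa using tendsto_pow_mul_exp_neg_atTop_nhds_zero 1
    refine squeeze_zero_norm' ?_ hlin
    filter_upwards [eventually_ge_atTop 1] with x hx
    simp only [Pi.mul_apply, norm_mul, norm_neg, norm_of_nonneg (exp_pos _).le,
      norm_of_nonneg (log_nonneg hx)]
    gcongr
    linarith [log_le_sub_one_of_pos (zero_lt_one.trans_le hx)]

theorem tendsto_integral_exp_neg_div_add_log :
    Tendsto (fun ε : ℝ => (∫ x in Ioi ε, exp (-x) / x) + log ε) (𝓝[>] 0)
      (𝓝 (-eulerMascheroniConstant)) := by
  have hlog : Tendsto (fun ε : ℝ => log ε * (1 - exp (-ε))) (𝓝[>] 0) (𝓝 0) := by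
    have hmul : Tendsto (fun ε : ℝ => log ε * ε) (𝓝[>] 0) (𝓝 0) := by
      simpa using tendsto_log_mul_rpow_nhdsGT_zero zero_lt_one
    refine squeeze_zero_norm' ?_ (by simpa using hmul.norm)
    filter_upwards [self_mem_nhdsWithin] with ε hε
    have hε : 0 < ε := hε
    have h1 : exp (-ε) ≤ 1 := exp_le_one_iff.mpr (by linarith)
    rw [norm_mul, norm_eq_abs, norm_eq_abs, abs_of_nonneg (sub_nonneg.mpr h1)]
    gcongr
    linarith [add_one_le_exp (-ε), le_abs_self ε]
  have h := (tendsto_setIntegral_Ioi_nhdsGT integrableOn_log_mul_exp_neg).add hlog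
  rw [integral_log_mul_exp_neg, add_zero] at h
  refine h.congr' ?_
  filter_upwards [self_mem_nhdsWithin] with ε hε
  rw [integral_exp_neg_div_Ioi hε]
  ring

theorem integrableOn_inv_sq_Ioi {ε : ℝ} (hε : 0 < ε) :
    IntegrableOn (fun u : ℝ => (u ^ 2)⁻¹) (Ioi ε) := by
  refine (integrableOn_Ioi_rpow_of_lt (a := -2) (by norm_num) hε).congr_fun ?_ measurableSet_Ioi
  intro u hu
  simp only [rpow_neg (hε.trans hu).le]
  norm_cast

theorem integrableOn_sin_div_sq_Ioi {ε : ℝ} (hε : 0 < ε) :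
    IntegrableOn (fun u : ℝ => sin u / u ^ 2) (Ioi ε) := by
  refine Integrable.mono' (integrableOn_inv_sq_Ioi hε) ?_ ?_
  · exact (by fun_prop : Measurable fun u : ℝ => sin u / u ^ 2).aestronglyMeasurable
  filter_upwards with u
  rw [norm_div, norm_of_nonneg (sq_nonneg u), ← one_div]
  gcongr
  exact abs_sin_le_one u

theorem integrableOn_sin_sub_mul_exp_neg_div_sq :
    IntegrableOn (fun u : ℝ => (sin u - u * exp (-u)) / u ^ 2) (Ioi 0) := by
  rw [← Ioc_union_Ioi_eq_Ioi zero_le_one]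
  refine IntegrableOn.union ?_ ?_
  · refine Measure.integrableOn_of_bounded (M := 2) (by simp) ?_ ?_
    · exact (by fun_prop : Measurable fun u : ℝ =>
        (sin u - u * exp (-u)) / u ^ 2).aestronglyMeasurable
    filter_upwards [ae_restrict_mem measurableSet_Ioc] with u ⟨h0, h1⟩
    rw [norm_div, norm_of_nonneg (sq_nonneg u), div_le_iff₀ (by positivity), norm_eq_abs,
      abs_le]
    have hsin := sin_gt_sub_cube h0
    have hsin' := sin_lt h0
    have hexp : u * (1 - u) ≤ u * exp (-u) := by
      gcongr
      linarith [add_one_le_exp (-u)]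
    have hexp' : u * exp (-u) ≤ u * 1 := by
      gcongr
      exact exp_le_one_iff.mpr (by linarith)
    constructor <;> nlinarith [mul_nonneg (sq_nonneg u) (sub_nonneg.mpr h1)]
  · refine ((integrableOn_sin_div_sq_Ioi one_pos).sub
      (integrableOn_exp_neg_div_Ioi one_pos)).congr_fun ?_ measurableSet_Ioi
    intro u hu
    have : u ≠ 0 := (zero_lt_one.trans hu).ne'
    simp only [Pi.sub_apply]
    field_simp

theorem integrableOn_mul_exp_neg_mul {r : ℝ} (hr : 0 < r) :
    IntegrableOn (fun t : ℝ => t * exp (-(r * t))) (Ioi 0) := by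
  have h := integral_rpow_mul_exp_neg_mul_Ioi (a := 2) two_pos hr
  norm_num at h
  refine not_imp_comm.mp integral_undef ?_
  rw [h]
  positivity

theorem integral_mul_exp_neg_mul {r : ℝ} (hr : 0 < r) :
    ∫ t in Ioi (0 : ℝ), t * exp (-(r * t)) = 1 / r ^ 2 := by
  have h := integral_rpow_mul_exp_neg_mul_Ioi (a := 2) two_pos hr
  norm_num at h
  rw [h]
  simp

theorem integrableOn_sin_mul_exp_neg_mul {t : ℝ} (ht : 0 < t) :
    IntegrableOn (fun u : ℝ => sin u * exp (-(u * t))) (Ioi 0) := by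
  refine Integrable.mono' (integrableOn_exp_mul_Ioi (a := -t) (by linarith) 0) (by fun_prop) ?_
  filter_upwards with u
  rw [norm_mul, norm_of_nonneg (exp_pos _).le, show -(u * t) = -t * u by ring]
  exact mul_le_of_le_one_left (exp_pos _).le (abs_sin_le_one u)

theorem integral_sin_mul_exp_neg_mul {t : ℝ} (ht : 0 < t) :
    ∫ u in Ioi (0 : ℝ), sin u * exp (-(u * t)) = 1 / (1 + t ^ 2) := by
  have hre : (-(t : ℂ) + Complex.I).re < 0 := by simpa
  have h := integral_exp_mul_complex_Ioi hre 0
  have him := integral_im (𝕜 := ℂ) (integrableOn_exp_mul_complex_Ioi hre 0)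
  rw [h] at him
  convert him using 1
  · congr with u
    simp [Complex.exp_im]
    ring_nf
  · simp [Complex.div_im, Complex.normSq_apply]
    ring_nf

theorem integral_mul_inv_one_add_sq_sub :
    ∫ t in Ioi (0 : ℝ), t * (1 / (1 + t ^ 2) - 1 / (1 + t) ^ 2) = 1 := by
  let F : ℝ → ℝ := fun s => log (1 - 2 * s + 2 * s ^ 2) / 2 - s
  have hpos (s : ℝ) : 0 < 1 - 2 * s + 2 * s ^ 2 := by nlinarith [sq_nonneg (2 * s - 1)]
  have hF (s : ℝ) :
      HasDerivAt F ((-2 + 4 * s) / (1 - 2 * s + 2 * s ^ 2) / 2 - 1) s := by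
    have hpoly : HasDerivAt (fun s : ℝ => 1 - 2 * s + 2 * s ^ 2) (-2 + 4 * s) s := by
      convert! (((hasDerivAt_id s).const_mul 2).const_sub 1).add
        ((hasDerivAt_pow 2 s).const_mul 2) using 1
      norm_num
      ring
    exact ((hpoly.log (hpos s).ne').div_const 2).sub (hasDerivAt_id s)
  have hderiv : ∀ t ∈ Ici (0 : ℝ), HasDerivAt (fun t => F (1 + t)⁻¹)
      (t * (1 / (1 + t ^ 2) - 1 / (1 + t) ^ 2)) t := by
    intro t ht
    have ht : 0 ≤ t := ht
    have h1 : 1 + t ≠ 0 := by positivity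
    have h2 : 1 + t ^ 2 ≠ 0 := by positivity
    convert! (hF (1 + t)⁻¹).comp t (((hasDerivAt_id t).const_add 1).fun_inv h1) using 1
    have : 1 - 2 * (1 + t)⁻¹ + 2 * (1 + t)⁻¹ ^ 2 = (1 + t ^ 2) / (1 + t) ^ 2 := by
      field_simp
      ring
    simp only [this, id]
    field_simp
    ring
  have hlim : Tendsto (fun t : ℝ => F (1 + t)⁻¹) atTop (𝓝 (F 0)) :=
    (hF 0).continuousAt.tendsto.comp
      (tendsto_inv_atTop_zero.comp (tendsto_atTop_add_const_left _ 1 tendsto_id))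
  rw [integral_Ioi_of_hasDerivAt_of_nonneg' hderiv ?_ hlim]
  · norm_num [F]
  · intro t ht
    have ht : 0 < t := ht
    refine mul_nonneg ht.le (sub_nonneg.mpr (one_div_le_one_div_of_le (by positivity) ?_))
    nlinarith

theorem integral_sin_sub_mul_exp_neg_div_sq :
    ∫ u in Ioi (0 : ℝ), (sin u - u * exp (-u)) / u ^ 2 = 1 := by
  let f : ℝ → ℝ → ℝ := fun u t => (sin u - u * exp (-u)) * (t * exp (-(u * t)))
  have hf : Integrable (Function.uncurry f)
      ((volume.restrict (Ioi 0)).prod (volume.restrict (Ioi 0))) := by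
    rw [integrable_prod_iff (by
      apply Continuous.aestronglyMeasurable
      simp only [f, Function.uncurry_def]
      fun_prop)]
    constructor
    · filter_upwards [ae_restrict_mem measurableSet_Ioi] with u hu
      exact (integrableOn_mul_exp_neg_mul hu).const_mul (sin u - u * exp (-u))
    · refine integrableOn_sin_sub_mul_exp_neg_div_sq.norm.congr ?_
      filter_upwards [ae_restrict_mem measurableSet_Ioi] with u hu
      have : ∀ t ∈ Ioi (0 : ℝ), ‖Function.uncurry f (u, t)‖ =
          ‖sin u - u * exp (-u)‖ * (t * exp (-(u * t))) := fun t ht => by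
        simp only [Function.uncurry, f, norm_mul]
        rw [norm_of_nonneg (le_of_lt ht), norm_of_nonneg (exp_pos _).le]
      rw [setIntegral_congr_fun measurableSet_Ioi this, integral_const_mul,
        integral_mul_exp_neg_mul hu, norm_div, norm_of_nonneg (sq_nonneg u), mul_one_div]
  calc ∫ u in Ioi (0 : ℝ), (sin u - u * exp (-u)) / u ^ 2
      = ∫ u in Ioi (0 : ℝ), ∫ t in Ioi (0 : ℝ), f u t := by
        refine setIntegral_congr_fun measurableSet_Ioi fun u hu => ?_
        simp only [f]
        rw [integral_const_mul, integral_mul_exp_neg_mul hu, mul_one_div]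
    _ = ∫ t in Ioi (0 : ℝ), ∫ u in Ioi (0 : ℝ), f u t := integral_integral_swap hf
    _ = ∫ t in Ioi (0 : ℝ), t * (1 / (1 + t ^ 2) - 1 / (1 + t) ^ 2) := by
        refine setIntegral_congr_fun measurableSet_Ioi fun t ht => ?_
        have ht : 0 < t := ht
        have ht1 : 0 < 1 + t := by linarith
        have hsplit (u : ℝ) : f u t =
            t * (sin u * exp (-(u * t)) - u * exp (-((1 + t) * u))) := by
          rw [show -((1 + t) * u) = -u + -(u * t) by ring, exp_add]
          ring
        simp only [hsplit]
        rw [integral_const_mul, integral_sub (integrableOn_sin_mul_exp_neg_mul ht)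
          (integrableOn_mul_exp_neg_mul ht1), integral_sin_mul_exp_neg_mul ht,
          integral_mul_exp_neg_mul ht1]
    _ = 1 := integral_mul_inv_one_add_sq_sub

/-- The limit `lim_{ε → 0⁺} (∫_ε^∞ sin u / u² du + log ε)` exists and equals `1 - γ`,
where `γ` is the Euler–Mascheroni constant. -/
theorem sin_div_sq_renormalized_limit :
    Tendsto (fun ε : ℝ => (∫ u in Set.Ioi ε, Real.sin u / u ^ 2) + Real.log ε)
      (nhdsWithin 0 (Set.Ioi 0)) (nhds (1 - Real.eulerMascheroniConstant)) := by
  have h := (tendsto_setIntegral_Ioi_nhdsGT integrableOn_sin_sub_mul_exp_neg_div_sq).add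
    tendsto_integral_exp_neg_div_add_log
  rw [integral_sin_sub_mul_exp_neg_div_sq, ← sub_eq_add_neg] at h
  refine h.congr' ?_
  filter_upwards [self_mem_nhdsWithin] with ε hε
  have hε : 0 < ε := hε
  rw [← add_assoc, ← integral_add
    (integrableOn_sin_sub_mul_exp_neg_div_sq.mono_set (Ioi_subset_Ioi hε.le))
    (integrableOn_exp_neg_div_Ioi hε)]
  congr 1
  refine setIntegral_congr_fun measurableSet_Ioi fun u hu => ?_
  have : u ≠ 0 := (hε.trans hu).ne'
  field_simp
  ring
end

section
/- Let ρ : ℝ → ℝ be a smooth even function, compactly supported in (−1,1), equal to 1 on a neighborhood of 0. Then, as T → ∞, −(1/π) ∫_0^∞ (d/dt)[ (sin(Tt)/t) · ρ(t) ] · log(sinh(t/2)) dt = −(T/π) log(2T) + (1−γ)(T/π) + O(1), where γ is the Euler–Mascheroni constant and sin(Tt)/t is extended by the value T at t = 0. -/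
open MeasureTheory Real Filter Asymptotics

lemma intervalIntegrable_inv_smul_of_differentiableAt {E : Type*} [NormedAddCommGroup E]
    [NormedSpace ℝ E] {f : ℝ → E} (hf : Continuous f) (hf₀ : DifferentiableAt ℝ f 0)
    (h0 : f 0 = 0) (a b : ℝ) :
    IntervalIntegrable (fun s : ℝ => s⁻¹ • f s) volume a b := by
  have hc : Continuous (dslope f 0) := by
    rw [← continuousOn_univ]
    exact (continuousOn_dslope Filter.univ_mem).2 ⟨hf.continuousOn, hf₀⟩
  refine (hc.intervalIntegrable a b).congr_ae (ae_restrict_of_ae ?_)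
  filter_upwards [Measure.ae_ne volume (0 : ℝ)] with s hs
  rw [dslope_of_ne _ hs, slope_def_module, h0, sub_zero, sub_zero]

lemma integral_log_mul_exp_neg_s8 :
    ∫ t in Set.Ioi (0 : ℝ), Real.log t * Real.exp (-t) = -Real.eulerMascheroniConstant := by
  have h1 := Complex.hasDerivAt_GammaIntegral (s := 1) (by simp)
  have h2 : HasDerivAt Complex.GammaIntegral (-(Real.eulerMascheroniConstant : ℂ)) 1 := by
    refine Complex.hasDerivAt_Gamma_one.congr_of_eventuallyEq ?_
    have : {z : ℂ | 0 < z.re} ∈ nhds (1 : ℂ) :=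
      (isOpen_lt continuous_const Complex.continuous_re).mem_nhds (by simp)
    filter_upwards [this] with z hz using (Complex.Gamma_eq_integral hz).symm
  have h3 := h1.unique h2
  simp only [sub_self, Complex.cpow_zero, one_mul, ← Complex.ofReal_mul] at h3
  have h4 := integral_ofReal (𝕜 := ℂ) (μ := volume.restrict (Set.Ioi (0 : ℝ)))
    (f := fun t : ℝ => Real.log t * Real.exp (-t))
  refine Complex.ofReal_injective (h4.symm.trans (h3.trans ?_))
  simp

lemma integrableOn_log_mul_exp_neg_s8 :
    IntegrableOn (fun t : ℝ => Real.log t * Real.exp (-t)) (Set.Ioi 0) := by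
  by_contra h
  have h1 := integral_undef h
  rw [integral_log_mul_exp_neg_s8] at h1
  linarith [Real.one_half_lt_eulerMascheroniConstant]

lemma integral_one_sub_exp_neg_div {T : ℝ} (hT : 0 < T) :
    ∫ s in (0 : ℝ)..1, s⁻¹ * (1 - Real.exp (-(T * s))) =
      (1 - Real.exp (-T)) * Real.log T - ∫ x in (0 : ℝ)..T, Real.log x * Real.exp (-x) := by
  have hsub : ∫ s in (0 : ℝ)..1, s⁻¹ * (1 - Real.exp (-(T * s))) =
      ∫ x in (0 : ℝ)..T, x⁻¹ * (1 - Real.exp (-x)) := by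
    have := intervalIntegral.mul_integral_comp_mul_left (a := 0) (b := 1)
      (f := fun x => x⁻¹ * (1 - Real.exp (-x))) (c := T)
    rw [mul_zero, mul_one] at this
    rw [← this, ← intervalIntegral.integral_const_mul]
    congr 1 with s
    rw [mul_inv]
    field_simp
  have hi1 : IntervalIntegrable (fun x : ℝ => x⁻¹ * (1 - Real.exp (-x))) volume 0 T :=
    intervalIntegrable_inv_smul_of_differentiableAt (f := fun x : ℝ => 1 - Real.exp (-x))
      (by fun_prop) (by fun_prop) (by simp) 0 T
  have hi2 : IntervalIntegrable (fun x : ℝ => Real.log x * Real.exp (-x)) volume 0 T :=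
    (intervalIntegrable_iff_integrableOn_Ioc_of_le hT.le).2
      (integrableOn_log_mul_exp_neg_s8.mono_set Set.Ioc_subset_Ioi_self)
  rw [hsub, eq_sub_iff_add_eq, ← intervalIntegral.integral_add hi1 hi2]
  have hd (x : ℝ) (hx : 0 < x) : HasDerivAt (fun x => (1 - Real.exp (-x)) * Real.log x)
      (x⁻¹ * (1 - Real.exp (-x)) + Real.log x * Real.exp (-x)) x := by
    have := (((hasDerivAt_neg x).exp).const_sub 1).mul (Real.hasDerivAt_log hx.ne')
    refine this.congr_deriv ?_
    ring
  have h0 : Tendsto (fun x => (1 - Real.exp (-x)) * Real.log x) (nhdsWithin 0 (Set.Ioi 0))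
      (nhds 0) := by
    have hlim := (tendsto_log_mul_rpow_nhdsGT_zero one_pos).abs
    rw [abs_zero] at hlim
    refine squeeze_zero_norm' ?_ hlim
    filter_upwards [self_mem_nhdsWithin] with x (hx : 0 < x)
    have h1 : |1 - Real.exp (-x)| ≤ |x| := by
      rw [abs_of_nonneg (by simpa using hx.le), abs_of_pos hx]
      linarith [Real.add_one_le_exp (-x)]
    rw [Real.norm_eq_abs, abs_mul, Real.rpow_one, abs_mul, mul_comm]
    gcongr
  rw [intervalIntegral.integral_eq_sub_of_hasDerivAt_of_tendsto hT
    (fun x hx => hd x hx.1) (hi1.add hi2) h0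
    ((hd T hT).continuousAt.tendsto.mono_left nhdsWithin_le_nhds), sub_zero]

lemma abs_integral_one_sub_exp_neg_div_sub_le {T : ℝ} (hT : 1 ≤ T) :
    |(∫ s in (0 : ℝ)..1, s⁻¹ * (1 - Real.exp (-(T * s)))) -
      (Real.log T + Real.eulerMascheroniConstant)| ≤ 4 / T := by
  have hT0 : 0 < T := by linarith
  have hsplit := intervalIntegral.integral_interval_add_Ioi
    (integrableOn_log_mul_exp_neg_s8) (integrableOn_log_mul_exp_neg_s8.mono_set
      (Set.Ioi_subset_Ioi hT0.le))
  rw [integral_log_mul_exp_neg_s8] at hsplit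
  have hexpT : Real.exp (-T) * T ^ 2 ≤ 2 := by
    have := Real.quadratic_le_exp_of_nonneg hT0.le
    rw [Real.exp_neg, inv_mul_le_iff₀ (Real.exp_pos _)]
    nlinarith
  have hlogT : 0 ≤ Real.log T := Real.log_nonneg hT
  have hlogT' : Real.log T ≤ T := (Real.log_le_sub_one_of_pos hT0).trans (by linarith)
  have hprim (x : ℝ) : HasDerivAt (fun x => -((x + 1) * Real.exp (-x))) (x * Real.exp (-x)) x := by
    have := (((hasDerivAt_id x).add_const 1).mul (hasDerivAt_neg x).exp).neg
    refine this.congr_deriv ?_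
    simp only [id]
    ring
  have htend : Tendsto (fun x : ℝ => -((x + 1) * Real.exp (-x))) atTop (nhds 0) := by
    have h1 := Real.tendsto_pow_mul_exp_neg_atTop_nhds_zero 1
    have h2 := Real.tendsto_pow_mul_exp_neg_atTop_nhds_zero 0
    simpa [add_mul] using (h1.add h2).neg
  have hpos (x : ℝ) (hx : x ∈ Set.Ioi T) : 0 ≤ x * Real.exp (-x) :=
    mul_nonneg (hT0.trans hx).le (Real.exp_pos _).le
  have hint := integrableOn_Ioi_deriv_of_nonneg' (fun x _ => hprim x) hpos htend
  have hval := integral_Ioi_of_hasDerivAt_of_nonneg' (fun x _ => hprim x) hpos htend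
  have htail_le : ∫ x in Set.Ioi T, Real.log x * Real.exp (-x) ≤ (T + 1) * Real.exp (-T) := by
    have : (T + 1) * Real.exp (-T) = ∫ x in Set.Ioi T, x * Real.exp (-x) := by
      rw [hval]; ring
    rw [this]
    refine setIntegral_mono_on (integrableOn_log_mul_exp_neg_s8.mono_set
      (Set.Ioi_subset_Ioi hT0.le)) hint measurableSet_Ioi fun x (hx : T < x) => ?_
    have := Real.log_le_sub_one_of_pos (hT0.trans hx)
    gcongr
    linarith
  have htail_nonneg : 0 ≤ ∫ x in Set.Ioi T, Real.log x * Real.exp (-x) :=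
    setIntegral_nonneg measurableSet_Ioi fun x (hx : T < x) =>
      mul_nonneg (Real.log_nonneg (by linarith)) (Real.exp_pos _).le
  have he := Real.exp_pos (-T)
  have hbound : (T + 1) * Real.exp (-T) ≤ 4 / T := by
    rw [le_div_iff₀ hT0]
    nlinarith
  have hlog : Real.exp (-T) * Real.log T ≤ (T + 1) * Real.exp (-T) := by nlinarith
  have hlog0 : 0 ≤ Real.exp (-T) * Real.log T := by positivity
  rw [integral_one_sub_exp_neg_div hT0, abs_le]
  constructor <;> linarith

/-- The entire exponential integral `∫₀¹ (1 - exp (-zs)) / s ds`. -/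
noncomputable def complexEin (z : ℂ) : ℂ :=
  ∫ s in (0 : ℝ)..1, s⁻¹ • (1 - Complex.exp (-(z * s)))

lemma intervalIntegrable_complexEin (z : ℂ) :
    IntervalIntegrable (fun s : ℝ => s⁻¹ • (1 - Complex.exp (-(z * s)))) volume 0 1 :=
  intervalIntegrable_inv_smul_of_differentiableAt
    (f := fun s : ℝ => 1 - Complex.exp (-(z * s))) (by fun_prop)
    (((Complex.ofRealCLM.differentiableAt.const_mul z).neg.cexp).const_sub 1) (by simp) 0 1

lemma hasDerivAt_complexEin {z : ℂ} (hz : z ≠ 0) :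
    HasDerivAt complexEin ((1 - Complex.exp (-z)) / z) z := by
  have key := (intervalIntegral.hasDerivAt_integral_of_dominated_loc_of_deriv_le
    (μ := volume) (a := 0) (b := 1) (x₀ := z) (s := Metric.ball z 1)
    (F := fun w (s : ℝ) => s⁻¹ • (1 - Complex.exp (-(w * s))))
    (F' := fun w (s : ℝ) => Complex.exp (-(w * s)))
    (bound := fun _ => Real.exp (‖z‖ + 1)) (Metric.ball_mem_nhds z one_pos)
    (Eventually.of_forall fun w => ?_) (intervalIntegrable_complexEin z)
    (Continuous.aestronglyMeasurable (by fun_prop)) ?_ intervalIntegrable_const ?_).2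
  · refine key.congr_deriv ?_
    have := integral_exp_mul_complex (a := 0) (b := 1) (neg_ne_zero.2 hz)
    simp only [neg_mul, Complex.ofReal_one, mul_one, Complex.ofReal_zero, mul_zero,
      Complex.exp_zero] at this
    rw [this, div_neg, ← neg_div, neg_sub]
  · have := (intervalIntegrable_complexEin w).def'.aestronglyMeasurable
    exact this
  · refine Eventually.of_forall fun s hs w hw => ?_
    rw [Set.uIoc_of_le zero_le_one] at hs
    rw [Complex.norm_exp, Real.exp_le_exp]
    refine (Complex.re_le_norm _).trans ?_
    rw [norm_neg, norm_mul, Complex.norm_real, Real.norm_eq_abs, abs_of_pos hs.1]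
    have h1 : ‖w‖ ≤ ‖z‖ + 1 := by
      have := norm_sub_norm_le w z
      rw [mem_ball_iff_norm] at hw
      linarith
    calc ‖w‖ * s ≤ ‖w‖ * 1 := by gcongr; exact hs.2
      _ ≤ _ := by linarith
  · refine Eventually.of_forall fun s hs w _ => ?_
    rw [Set.uIoc_of_le zero_le_one] at hs
    have h1 := ((((hasDerivAt_id w).mul_const (s : ℂ)).neg.cexp).const_sub 1).const_smul s⁻¹
    refine h1.congr_deriv ?_
    have : (s : ℂ) ≠ 0 := by exact_mod_cast hs.1.ne'
    simp only [id, Pi.neg_apply, Complex.real_smul, Complex.ofReal_inv]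
    field_simp

lemma complexEin_ofReal_re (T : ℝ) :
    (complexEin T).re = ∫ s in (0 : ℝ)..1, s⁻¹ * (1 - Real.exp (-(T * s))) := by
  have := Complex.reCLM.intervalIntegral_comp_comm (intervalIntegrable_complexEin T)
  rw [complexEin, ← Complex.reCLM_apply, ← this]
  congr 1 with s
  simp [← Complex.ofReal_mul, ← Complex.ofReal_neg, Complex.exp_ofReal_re]

lemma complexEin_mul_I_re (T : ℝ) :
    (complexEin (T * Complex.I)).re = ∫ s in (0 : ℝ)..1, s⁻¹ * (1 - Real.cos (T * s)) := by
  have := Complex.reCLM.intervalIntegral_comp_comm (intervalIntegrable_complexEin (T * Complex.I))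
  rw [complexEin, ← Complex.reCLM_apply, ← this]
  congr 1 with s
  simp [Complex.exp_re]

lemma norm_complexEin_mul_I_sub_le {T : ℝ} (hT : 0 < T) :
    ‖complexEin (T * Complex.I) - complexEin T - (π / 2 : ℝ) * Complex.I‖ ≤ π / (2 * T) := by
  have hπ := Real.pi_pos
  have hγ (θ : ℝ) : HasDerivAt (fun θ : ℝ => (T : ℂ) * Complex.exp (θ * Complex.I))
      (T * Complex.exp (θ * Complex.I) * Complex.I) θ := by
    have h1 : HasDerivAt (fun θ : ℝ => (θ : ℂ) * Complex.I) Complex.I θ := by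
      simpa using (Complex.ofRealCLM.hasDerivAt (x := θ)).mul_const Complex.I
    refine (h1.cexp.const_mul (T : ℂ)).congr_deriv ?_
    ring
  have hderiv (θ : ℝ) : HasDerivAt (fun θ : ℝ => complexEin (T * Complex.exp (θ * Complex.I))
      - complexEin T - θ * Complex.I)
      (-Complex.exp (-(T * Complex.exp (θ * Complex.I))) * Complex.I) θ := by
    have hne : (T : ℂ) * Complex.exp (θ * Complex.I) ≠ 0 :=
      mul_ne_zero (by exact_mod_cast hT.ne') (Complex.exp_ne_zero _)
    have h1 : HasDerivAt (fun θ : ℝ => (θ : ℂ) * Complex.I) Complex.I θ := by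
      simpa using (Complex.ofRealCLM.hasDerivAt (x := θ)).mul_const Complex.I
    have h2 := (((hasDerivAt_complexEin hne).comp θ (hγ θ)).sub_const (complexEin T)).sub h1
    refine h2.congr_deriv ?_
    rw [div_mul_eq_mul_div, ← mul_assoc, mul_right_comm, mul_div_cancel_right₀ _ hne]
    ring
  have hB (θ : ℝ) : HasDerivAt
      (fun θ : ℝ => π / (2 * T) * Real.exp (-(T * (1 - 2 / π * θ))))
      (Real.exp (-(T * (1 - 2 / π * θ)))) θ := by
    have h1 := (((((hasDerivAt_id θ).const_mul (2 / π)).const_sub 1).const_mul T).neg.exp).const_mul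
      (π / (2 * T))
    refine h1.congr_deriv ?_
    simp only [id, Pi.neg_apply]
    field_simp
  have := image_norm_le_of_norm_deriv_right_le_deriv_boundary (a := 0) (b := π / 2)
    (fun θ _ => (hderiv θ).continuousAt.continuousWithinAt)
    (fun θ _ => (hderiv θ).hasDerivWithinAt) (by simp; positivity) hB (fun θ hθ => ?_)
    (Set.right_mem_Icc.2 (by positivity))
  · have h1 : 1 - 2 / π * (π / 2) = 0 := by field_simp; ring
    rw [h1] at this
    simpa [Complex.exp_pi_div_two_mul_I] using this
  · rw [norm_mul, Complex.norm_I, mul_one, norm_neg, Complex.norm_exp, Real.exp_le_exp,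
      Complex.neg_re, Complex.re_ofReal_mul, Complex.exp_ofReal_mul_I_re]
    have := Real.one_sub_mul_le_cos hθ.1 hθ.2.le
    gcongr

lemma abs_integral_one_sub_cos_div_sub_le {T : ℝ} (hT : 1 ≤ T) :
    |(∫ s in (0 : ℝ)..1, s⁻¹ * (1 - Real.cos (T * s))) -
      (Real.log T + Real.eulerMascheroniConstant)| ≤ 6 / T := by
  have hT0 : 0 < T := by linarith
  have h1 := (Complex.abs_re_le_norm _).trans (norm_complexEin_mul_I_sub_le hT0)
  rw [Complex.sub_re, Complex.sub_re, Complex.re_ofReal_mul, Complex.I_re, mul_zero, sub_zero,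
    complexEin_ofReal_re, complexEin_mul_I_re] at h1
  have h2 := abs_integral_one_sub_exp_neg_div_sub_le hT
  have h3 : π / (2 * T) ≤ 2 / T := by
    rw [div_le_div_iff₀ (by positivity) hT0]
    nlinarith [Real.pi_le_four]
  have h4 : 6 / T = 4 / T + 2 / T := by ring
  rw [abs_le] at *
  constructor <;> linarith

lemma sinh_le_self_mul_cosh {u : ℝ} (hu : 0 ≤ u) : Real.sinh u ≤ u * Real.cosh u := by
  have hd (x : ℝ) : HasDerivAt (fun x => x * Real.cosh x - Real.sinh x) (x * Real.sinh x) x := by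
    refine (((hasDerivAt_id x).mul (Real.hasDerivAt_cosh x)).sub
      (Real.hasDerivAt_sinh x)).congr_deriv ?_
    simp only [id]
    ring
  have hmono : MonotoneOn (fun x => x * Real.cosh x - Real.sinh x) (Set.Ici 0) := by
    refine monotoneOn_of_deriv_nonneg (convex_Ici 0)
      (fun x _ => (hd x).continuousAt.continuousWithinAt)
      (fun x _ => (hd x).differentiableAt.differentiableWithinAt) fun x hx => ?_
    rw [interior_Ici] at hx
    rw [(hd x).deriv]
    exact mul_nonneg hx.le (Real.sinh_nonneg_iff.2 hx.le)
  have := hmono (Set.mem_Ici.2 le_rfl) hu hu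
  simp only [Real.sinh_zero, zero_mul, sub_zero] at this
  linarith

lemma cosh_sub_one_le_sq {u : ℝ} (hu : |u| ≤ 1) : Real.cosh u - 1 ≤ u ^ 2 := by
  have h1 := Real.cosh_le_exp_half_sq u
  have h2 : u ^ 2 ≤ 1 := by nlinarith [sq_abs u, abs_nonneg u]
  have h3 := Real.norm_exp_sub_one_sub_id_le (x := u ^ 2 / 2)
    (by rw [Real.norm_of_nonneg (by positivity)]; linarith)
  rw [Real.norm_eq_abs, Real.norm_of_nonneg (by positivity), abs_le] at h3
  nlinarith [sq_nonneg u]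

lemma abs_cosh_div_sinh_sub_inv_le {u : ℝ} (h0 : 0 < u) (h1 : u ≤ 1) :
    |Real.cosh u / Real.sinh u - u⁻¹| ≤ u := by
  have hs : 0 < Real.sinh u := Real.sinh_pos_iff.2 h0
  have hs' : u ≤ Real.sinh u := Real.self_le_sinh_iff.2 h0.le
  have hc := cosh_sub_one_le_sq (by rwa [abs_of_pos h0])
  have he : Real.cosh u / Real.sinh u - u⁻¹ =
      (u * Real.cosh u - Real.sinh u) / (u * Real.sinh u) := by
    field_simp
  rw [he, abs_of_nonneg
    (div_nonneg (sub_nonneg.2 (sinh_le_self_mul_cosh h0.le)) (by positivity)),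
    div_le_iff₀ (by positivity)]
  nlinarith [mul_le_mul_of_nonneg_left hc h0.le, mul_le_mul_of_nonneg_left hs' (sq_nonneg u)]

lemma tendsto_sinh_half_div_self :
    Tendsto (fun t : ℝ => Real.sinh (t / 2) / t) (nhdsWithin 0 (Set.Ioi 0)) (nhds (1 / 2)) := by
  have h : HasDerivAt (fun t : ℝ => Real.sinh (t / 2)) (1 / 2) 0 := by
    refine ((hasDerivAt_id (0 : ℝ)).div_const 2).sinh.congr_deriv ?_
    simp
  have := (hasDerivAt_iff_tendsto_slope_zero.1 h).mono_left
    (nhdsWithin_mono 0 fun x (hx : 0 < x) => hx.ne')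
  refine this.congr fun t => ?_
  simp [div_eq_inv_mul]

lemma tendsto_log_sinh_half_sub_log :
    Tendsto (fun t : ℝ => Real.log (Real.sinh (t / 2)) - Real.log t) (nhdsWithin 0 (Set.Ioi 0))
      (nhds (-Real.log 2)) := by
  have h := tendsto_sinh_half_div_self.log (by norm_num)
  rw [one_div, Real.log_inv] at h
  refine h.congr' ?_
  filter_upwards [self_mem_nhdsWithin] with t (ht : 0 < t)
  rw [Real.log_div (Real.sinh_pos_iff.2 (by positivity)).ne' ht.ne']

lemma abs_log_sinh_half_le {t : ℝ} (h0 : 0 < t) (h1 : t ≤ 1) :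
    |Real.log (Real.sinh (t / 2))| ≤ |Real.log t| + Real.log 2 := by
  have hs : t / 2 ≤ Real.sinh (t / 2) := Real.self_le_sinh_iff.2 (by positivity)
  have hs1 : Real.sinh (t / 2) ≤ 1 := by
    have h2 := sinh_le_self_mul_cosh (u := t / 2) (by positivity)
    have h3 := cosh_sub_one_le_sq (u := t / 2) (by rw [abs_of_pos (by positivity)]; linarith)
    nlinarith
  have h4 := Real.log_le_log (by positivity) hs
  rw [Real.log_div h0.ne' two_ne_zero] at h4
  rw [abs_of_nonpos (Real.log_nonpos (by linarith) hs1), abs_of_nonpos (Real.log_nonpos h0.le h1)]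
  linarith

lemma hasDerivAt_log_sinh_half {t : ℝ} (ht : 0 < t) :
    HasDerivAt (fun t : ℝ => Real.log (Real.sinh (t / 2)))
      (Real.cosh (t / 2) / Real.sinh (t / 2) / 2) t := by
  have h := ((hasDerivAt_id t).div_const 2).sinh.log
    (Real.sinh_pos_iff.2 (show 0 < id t / 2 by simpa using ht)).ne'
  refine h.congr_deriv ?_
  simp only [id]
  ring

lemma hasDerivAt_sin_mul_div (T : ℝ) {t : ℝ} (ht : 0 < t) :
    HasDerivAt (fun u : ℝ => Real.sin (T * u) / u)
      ((T * t * Real.cos (T * t) - Real.sin (T * t)) / t ^ 2) t := by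
  have h := ((hasDerivAt_id t).const_mul T).sin.div (hasDerivAt_id t) ht.ne'
  refine h.congr_deriv ?_
  simp only [id]
  ring

lemma abs_mul_cos_sub_sin_le {x : ℝ} (hx : 0 < x) : |x * Real.cos x - Real.sin x| ≤ x ^ 3 := by
  have h1 := Real.sin_gt_sub_cube hx
  have h2 := Real.sin_lt hx
  have h3 := Real.cos_le_one x
  have h4 := Real.one_sub_sq_div_two_le_cos (x := x)
  have h5 := mul_le_mul_of_nonneg_left h3 hx.le
  have h6 := mul_le_mul_of_nonneg_left h4 hx.le
  have h7 : 0 < x ^ 3 := by positivity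
  rw [abs_le]
  constructor <;> nlinarith

lemma abs_sin_mul_div_sub_le {T t : ℝ} (hT : 0 < T) (ht : 0 < t) :
    |Real.sin (T * t) / t - T| ≤ T ^ 3 * t ^ 2 := by
  have hTt : 0 < T * t := by positivity
  have h1 := Real.sin_gt_sub_cube hTt
  have h2 := Real.sin_lt hTt
  have he : Real.sin (T * t) / t - T = (Real.sin (T * t) - T * t) / t := by field_simp
  have h7 : 0 < (T * t) ^ 3 := by positivity
  rw [he, abs_div, abs_of_pos ht, div_le_iff₀ ht, abs_of_neg (by linarith)]
  nlinarith

/-- The bounded part of `(d/dt)[(sin (Tt) / t) ρ(t)] * log (sinh (t / 2))` that is left after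
removing an exact derivative and `T (1 - cos (Tt)) / t`. -/
noncomputable def logSinhRemainder (ρ : ℝ → ℝ) (T t : ℝ) : ℝ :=
  (1 - ρ t) / t ^ 2 * Real.sin (T * t) -
    ρ t * Real.sin (T * t) * ((Real.cosh (t / 2) / Real.sinh (t / 2) / 2 - t⁻¹) / t)

lemma exists_abs_logSinhRemainder_le {ρ : ℝ → ℝ} (hρ : Continuous ρ)
    (hone : ∀ᶠ t in nhds (0:ℝ), ρ t = 1) :
    ∃ C, ∀ T t : ℝ, 0 < t → t ≤ 1 → |logSinhRemainder ρ T t| ≤ C := by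
  obtain ⟨B, hB⟩ := isCompact_Icc.exists_bound_of_continuousOn (s := Set.Icc (0 : ℝ) 1)
    hρ.continuousOn
  obtain ⟨δ, hδ, hδ1⟩ := Metric.eventually_nhds_iff.1 hone
  have hB0 : 0 ≤ B := (norm_nonneg _).trans (hB 0 (by simp))
  refine ⟨(1 + B) / δ ^ 2 + B, fun T t h0 h1 => ?_⟩
  have hs := Real.abs_sin_le_one (T * t)
  have hBt := hB t ⟨h0.le, h1⟩
  rw [Real.norm_eq_abs] at hBt
  refine (abs_sub _ _).trans (add_le_add ?_ ?_)
  · rw [abs_mul]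
    refine (mul_le_of_le_one_right (abs_nonneg _) hs).trans ?_
    by_cases ht : t < δ
    · rw [hδ1 (by rwa [Real.dist_eq, sub_zero, abs_of_pos h0])]
      simp only [sub_self, zero_div, abs_zero]
      positivity
    · push Not at ht
      rw [abs_div, abs_of_pos (a := t ^ 2) (by positivity)]
      gcongr
      refine (abs_sub _ _).trans ?_
      rw [abs_one]
      gcongr
  · have hr := abs_cosh_div_sinh_sub_inv_le (u := t / 2) (by positivity) (by linarith)
    have he : (Real.cosh (t / 2) / Real.sinh (t / 2) / 2 - t⁻¹) / t =
        (Real.cosh (t / 2) / Real.sinh (t / 2) - (t / 2)⁻¹) / (2 * t) := by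
      field_simp
    have hq : |(Real.cosh (t / 2) / Real.sinh (t / 2) / 2 - t⁻¹) / t| ≤ 1 := by
      rw [he, abs_div, abs_of_pos (a := 2 * t) (by positivity), div_le_one (by positivity)]
      linarith
    rw [abs_mul, abs_mul]
    calc |ρ t| * |Real.sin (T * t)| * _ ≤ B * 1 * 1 := by gcongr
      _ = B := by ring

lemma intervalIntegrable_logSinhRemainder {ρ : ℝ → ℝ} (hρ : Continuous ρ)
    (hone : ∀ᶠ t in nhds (0:ℝ), ρ t = 1) (T : ℝ) :
    IntervalIntegrable (logSinhRemainder ρ T) volume 0 1 := by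
  obtain ⟨C, hC⟩ := exists_abs_logSinhRemainder_le hρ hone
  refine (intervalIntegrable_const (c := C)).mono_fun ?_ ?_
  · have := hρ.measurable
    have : Measurable (logSinhRemainder ρ T) := by
      unfold logSinhRemainder
      fun_prop
    exact this.aestronglyMeasurable
  · rw [Filter.EventuallyLE, ae_restrict_iff' measurableSet_uIoc]
    refine Eventually.of_forall fun t ht => ?_
    rw [Set.uIoc_of_le zero_le_one] at ht
    exact (hC T t ht.1 ht.2).trans (le_abs_self C)

lemma hasDerivAt_ite_sin_mul_div_mul {ρ : ℝ → ℝ} (hρ : Differentiable ℝ ρ) (T : ℝ) {t : ℝ}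
    (ht : 0 < t) :
    HasDerivAt (fun u : ℝ => (if u = 0 then T else Real.sin (T * u) / u) * ρ u)
      ((T * t * Real.cos (T * t) - Real.sin (T * t)) / t ^ 2 * ρ t +
        Real.sin (T * t) / t * deriv ρ t) t := by
  refine ((hasDerivAt_sin_mul_div T ht).mul (hρ t).hasDerivAt).congr_of_eventuallyEq ?_
  filter_upwards [lt_mem_nhds ht] with u hu
  simp [hu.ne']

lemma intervalIntegrable_deriv_mul_log_sinh {ρ : ℝ → ℝ} (hρ : ContDiff ℝ 1 ρ) {T : ℝ}
    (hT : 0 < T) :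
    IntervalIntegrable (fun t : ℝ =>
      deriv (fun u : ℝ => (if u = 0 then T else Real.sin (T * u) / u) * ρ u) t *
        Real.log (Real.sinh (t / 2))) volume 0 1 := by
  obtain ⟨B, hB⟩ := isCompact_Icc.exists_bound_of_continuousOn (s := Set.Icc (0 : ℝ) 1)
    hρ.continuous.continuousOn
  obtain ⟨B', hB'⟩ := isCompact_Icc.exists_bound_of_continuousOn (s := Set.Icc (0 : ℝ) 1)
    (hρ.continuous_deriv le_rfl).continuousOn
  have hdom : IntervalIntegrable (fun t : ℝ => (T ^ 3 * B + T * B') * (|Real.log t| + Real.log 2))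
      volume 0 1 :=
    (intervalIntegral.intervalIntegrable_log'.abs.add intervalIntegrable_const).const_mul _
  refine hdom.mono_fun ?_ ?_
  · exact ((measurable_deriv _).mul (by fun_prop)).aestronglyMeasurable
  · rw [Filter.EventuallyLE, ae_restrict_iff' measurableSet_uIoc]
    refine Eventually.of_forall fun t ht => ?_
    rw [Set.uIoc_of_le zero_le_one] at ht
    obtain ⟨h0, h1⟩ := ht
    refine le_trans ?_ (le_abs_self _)
    rw [(hasDerivAt_ite_sin_mul_div_mul (hρ.differentiable one_ne_zero) T h0).deriv, norm_mul]
    have hTt : 0 < T * t := by positivity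
    have hS' : |(T * t * Real.cos (T * t) - Real.sin (T * t)) / t ^ 2| ≤ T ^ 3 := by
      rw [abs_div, abs_of_pos (a := t ^ 2) (by positivity), div_le_iff₀ (by positivity)]
      refine (abs_mul_cos_sub_sin_le hTt).trans ?_
      rw [mul_pow]
      gcongr ?_ * ?_
      exact pow_le_pow_of_le_one h0.le h1 (by norm_num)
    have hS : |Real.sin (T * t) / t| ≤ T := by
      rw [abs_div, abs_of_pos h0, div_le_iff₀ h0]
      simpa [abs_of_pos hTt] using Real.abs_sin_le_abs (x := T * t)
    have hBt := hB t ⟨h0.le, h1⟩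
    have hBt' := hB' t ⟨h0.le, h1⟩
    have hB0 : 0 ≤ B := (norm_nonneg _).trans hBt
    have hB0' : 0 ≤ B' := (norm_nonneg _).trans hBt'
    refine mul_le_mul ?_ (abs_log_sinh_half_le h0 h1) (norm_nonneg _) (by positivity)
    refine (norm_add_le _ _).trans ?_
    rw [norm_mul, norm_mul]
    exact add_le_add (mul_le_mul hS' hBt (norm_nonneg _) (by positivity))
      (mul_le_mul hS hBt' (norm_nonneg _) hT.le)

lemma integral_deriv_mul_log_sinh {ρ : ℝ → ℝ} (hρ : ContDiff ℝ 1 ρ) (h1 : ρ 1 = 0)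
    (hone : ∀ᶠ t in nhds (0:ℝ), ρ t = 1) {T : ℝ} (hT : 0 < T) :
    ∫ t in (0 : ℝ)..1,
      deriv (fun u : ℝ => (if u = 0 then T else Real.sin (T * u) / u) * ρ u) t *
        Real.log (Real.sinh (t / 2)) =
    Real.sin T + T * Real.log 2 - T +
      T * (∫ s in (0 : ℝ)..1, s⁻¹ * (1 - Real.cos (T * s))) +
      ∫ t in (0 : ℝ)..1, logSinhRemainder ρ T t := by
  have hint1 := intervalIntegrable_deriv_mul_log_sinh hρ hT
  have hint2 : IntervalIntegrable (fun s : ℝ => T * (s⁻¹ * (1 - Real.cos (T * s)))) volume 0 1 :=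
    (intervalIntegrable_inv_smul_of_differentiableAt (f := fun s : ℝ => 1 - Real.cos (T * s))
      (by fun_prop) (by fun_prop) (by simp) 0 1).const_mul T
  have hint3 := intervalIntegrable_logSinhRemainder hρ.continuous hone T
  have hd (t : ℝ) (ht : 0 < t) : HasDerivAt
      (fun t : ℝ => Real.sin (T * t) / t * ρ t * Real.log (Real.sinh (t / 2)) - T * Real.log t +
        Real.sin (T * t) / t)
      (deriv (fun u : ℝ => (if u = 0 then T else Real.sin (T * u) / u) * ρ u) t *
        Real.log (Real.sinh (t / 2)) - T * (t⁻¹ * (1 - Real.cos (T * t))) -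
          logSinhRemainder ρ T t) t := by
    have hρd := hρ.differentiable one_ne_zero
    have hS := hasDerivAt_sin_mul_div T ht
    rw [(hasDerivAt_ite_sin_mul_div_mul hρd T ht).deriv]
    refine ((((hS.mul (hρd t).hasDerivAt).mul (hasDerivAt_log_sinh_half ht)).sub
      ((Real.hasDerivAt_log ht.ne').const_mul T)).add hS).congr_deriv ?_
    simp only [logSinhRemainder, Pi.mul_apply]
    have hs := (Real.sinh_pos_iff.2 (show 0 < t / 2 by positivity)).ne'
    field_simp
    ring
  have hlim1 : Tendsto
      (fun t : ℝ => Real.sin (T * t) / t * ρ t * Real.log (Real.sinh (t / 2)) - T * Real.log t +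
        Real.sin (T * t) / t) (nhdsWithin 1 (Set.Iio 1)) (nhds (Real.sin T)) := by
    have := (hd 1 one_pos).continuousAt.tendsto.mono_left (nhdsWithin_le_nhds (s := Set.Iio 1))
    simpa [h1] using this
  have hS0 : Tendsto (fun t : ℝ => Real.sin (T * t) / t) (nhdsWithin 0 (Set.Ioi 0)) (nhds T) := by
    have h : HasDerivAt (fun t : ℝ => Real.sin (T * t)) T 0 := by
      refine ((hasDerivAt_id (0 : ℝ)).const_mul T).sin.congr_deriv ?_
      simp
    have := (hasDerivAt_iff_tendsto_slope_zero.1 h).mono_left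
      (nhdsWithin_mono 0 fun x (hx : 0 < x) => hx.ne')
    refine this.congr fun t => ?_
    simp [div_eq_inv_mul]
  have hprod : Tendsto (fun t : ℝ => (Real.sin (T * t) / t - T) * Real.log (Real.sinh (t / 2)))
      (nhdsWithin 0 (Set.Ioi 0)) (nhds 0) := by
    have hid : Tendsto (fun t : ℝ => t) (nhdsWithin 0 (Set.Ioi 0)) (nhds 0) :=
      tendsto_id.mono_left nhdsWithin_le_nhds
    have hlog := (tendsto_log_mul_rpow_nhdsGT_zero one_pos).abs
    have hb := ((hlog.add (hid.const_mul (Real.log 2))).const_mul (T ^ 3))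
    rw [abs_zero, mul_zero, add_zero, mul_zero] at hb
    refine squeeze_zero_norm' ?_ hb
    filter_upwards [Ioc_mem_nhdsGT one_pos] with t ⟨ht0, ht1⟩
    rw [norm_mul, Real.rpow_one, abs_mul, abs_of_pos ht0]
    have ha : |Real.sin (T * t) / t - T| ≤ T ^ 3 * t := by
      refine (abs_sin_mul_div_sub_le hT ht0).trans ?_
      gcongr
      nlinarith
    calc _ ≤ T ^ 3 * t * (|Real.log t| + Real.log 2) :=
          mul_le_mul ha (abs_log_sinh_half_le ht0 ht1) (abs_nonneg _) (by positivity)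
      _ = _ := by ring
  have hlim0 : Tendsto
      (fun t : ℝ => Real.sin (T * t) / t * ρ t * Real.log (Real.sinh (t / 2)) - T * Real.log t +
        Real.sin (T * t) / t) (nhdsWithin 0 (Set.Ioi 0)) (nhds (T - T * Real.log 2)) := by
    have h := (hprod.add (tendsto_log_sinh_half_sub_log.const_mul T)).add hS0
    rw [show 0 + T * -Real.log 2 + T = T - T * Real.log 2 by ring] at h
    refine h.congr' ?_
    filter_upwards [nhdsWithin_le_nhds hone] with t ht
    rw [ht]
    ring
  have hftc := intervalIntegral.integral_eq_sub_of_hasDerivAt_of_tendsto one_pos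
    (fun t ht => hd t ht.1) ((hint1.sub hint2).sub hint3) hlim0 hlim1
  rw [intervalIntegral.integral_sub (hint1.sub hint2) hint3,
    intervalIntegral.integral_sub hint1 hint2, intervalIntegral.integral_const_mul] at hftc
  linarith

lemma integral_Ioi_deriv_mul_eq {ρ : ℝ → ℝ} (hsupp : tsupport ρ ⊆ Set.Ioo (-1 : ℝ) 1)
    (g h : ℝ → ℝ) :
    ∫ t in Set.Ioi (0:ℝ), deriv (fun u => g u * ρ u) t * h t =
      ∫ t in (0 : ℝ)..1, deriv (fun u => g u * ρ u) t * h t := by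
  rw [intervalIntegral.integral_of_le zero_le_one]
  refine (setIntegral_eq_of_subset_of_forall_sdiff_eq_zero measurableSet_Ioi
    Set.Ioc_subset_Ioi_self fun t ht => ?_)
  have ht1 : t ∉ tsupport ρ := fun hmem =>
    ht.2 ⟨ht.1, (hsupp hmem).2.le⟩
  have hev : (fun u => g u * ρ u) =ᶠ[nhds t] fun _ => 0 := by
    filter_upwards [notMem_tsupport_iff_eventuallyEq.1 ht1] with u hu
    simp [hu]
  rw [hev.deriv_eq]
  simp

/-- Let `ρ` be a smooth even function, compactly supported in `(-1,1)` and equal to `1` near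
`0`. Then, as `T → ∞`,
`-(1/π) ∫₀^∞ (d/dt)[(sin(Tt)/t) ρ(t)] log(sinh(t/2)) dt
  = -(T/π) log(2T) + (1-γ)(T/π) + O(1)`,
where `γ` is the Euler–Mascheroni constant and `sin(Tt)/t` is extended by the value `T`
at `t = 0`. -/
theorem oscillatory_integral_log_sinh (ρ : ℝ → ℝ)
    (hρ : ContDiff ℝ (⊤ : ℕ∞) ρ)
    (hsupp : tsupport ρ ⊆ Set.Ioo (-1 : ℝ) 1)
    (heven : ∀ t : ℝ, ρ (-t) = ρ t)
    (hone : ∀ᶠ t in nhds (0:ℝ), ρ t = 1) :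
    (fun T : ℝ =>
      (-(1 / π) * ∫ t in Set.Ioi (0:ℝ),
          deriv (fun u : ℝ => (if u = 0 then T else Real.sin (T * u) / u) * ρ u) t *
            Real.log (Real.sinh (t / 2)))
        - (-(T / π) * Real.log (2 * T)
            + (1 - Real.eulerMascheroniConstant) * (T / π)))
      =O[atTop] (fun _ : ℝ => (1 : ℝ)) := by
  have hρ1 : ContDiff ℝ 1 ρ := hρ.of_le (by exact_mod_cast le_top)
  have hρ_one : ρ 1 = 0 := image_eq_zero_of_notMem_tsupport fun h => lt_irrefl _ (hsupp h).2
  obtain ⟨C, hC⟩ := exists_abs_logSinhRemainder_le hρ1.continuous hone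
  refine IsBigO.of_bound (1 / π * (1 + 6 + C)) ?_
  filter_upwards [eventually_ge_atTop 1] with T hT
  have hT0 : 0 < T := by linarith
  rw [integral_Ioi_deriv_mul_eq hsupp, integral_deriv_mul_log_sinh hρ1 hρ_one hone hT0,
    Real.log_mul two_ne_zero hT0.ne']
  have hK := abs_integral_one_sub_cos_div_sub_le hT
  have hR : |∫ t in (0 : ℝ)..1, logSinhRemainder ρ T t| ≤ C := by
    have := intervalIntegral.norm_integral_le_of_norm_le_const (a := 0) (b := 1) (C := C)
      (f := logSinhRemainder ρ T) fun t ht => by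
        rw [Set.uIoc_of_le zero_le_one] at ht
        exact hC T t ht.1 ht.2
    simpa using this
  set K := ∫ s in (0 : ℝ)..1, s⁻¹ * (1 - Real.cos (T * s))
  set R := ∫ t in (0 : ℝ)..1, logSinhRemainder ρ T t
  have hTK : |T * (K - (Real.log T + Real.eulerMascheroniConstant))| ≤ 6 := by
    rw [abs_mul, abs_of_pos hT0]
    calc _ ≤ T * (6 / T) := by gcongr
      _ = 6 := by field_simp
  have he : -(1 / π) * (Real.sin T + T * Real.log 2 - T + T * K + R) -
      (-(T / π) * (Real.log 2 + Real.log T) + (1 - Real.eulerMascheroniConstant) * (T / π)) =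
      -(1 / π) * (Real.sin T + T * (K - (Real.log T + Real.eulerMascheroniConstant)) + R) := by
    ring
  rw [he, norm_mul, norm_neg, Real.norm_of_nonneg (by positivity), norm_one, mul_one]
  gcongr
  exact (abs_add_three _ _ _).trans (by gcongr; exact Real.abs_sin_le_one T)
end
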